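/- Under the standing hypotheses, if r and s are involutions of G with r ∉ A and s ∉ A, and s = a·r·b for some a, b ∈ A, then b = a⁻¹. -/

import Mathlib

/-- An involution: an element of order 2. -/
def IsInvol {G : Type*} [Group G] (s : G) : Prop := orderOf s = 2

/-- `s₁ ∼_j s₂`: there are nonzero integers `m, n` with `(j·s₁)^m = (j·s₂)^n`. -/
def JEquiv {G : Type*} [Group G] (j s₁ s₂ : G) : Prop :=
  ∃ m n : ℤ, m ≠ 0 ∧ n ≠ 0 ∧ (j * s₁) ^ m = (j * s₂) ^ n

/-- `s₁` is minimal relative to `j`: `⟨j, s₂⟩ ≤ ⟨j, s₁⟩` for every involution `s₂ ∼_j s₁`. -/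
def JMinimal {G : Type*} [Group G] (j s₁ : G) : Prop :=
  ∀ s₂ : G, IsInvol s₂ → JEquiv j s₂ s₁ →
    Subgroup.closure ({j, s₂} : Set G) ≤ Subgroup.closure ({j, s₁} : Set G)

/-- The standing hypotheses (1)–(6) on `G`, `j`, `t`, `t'`. -/
structure StandingHyp {G : Type*} [Group G] (j t t' : G) : Prop where
  invol_j : IsInvol j
  invol_t : IsInvol t
  invol_t' : IsInvol t'
  tconj : t' * j * t' = t
  all_conj : ∀ s₁ s₂ : G, IsInvol s₁ → IsInvol s₂ → IsConj s₁ s₂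
  infinite_order : ∀ r s : G, IsInvol r → IsInvol s → r ≠ s → ¬ IsOfFinOrder (r * s)
  unique_root : ∀ n : ℕ, 0 < n → ∃! s : G, IsInvol s ∧ (j * s) ^ n = j * t
  conj_in_A : ∀ s : G, IsInvol s → JEquiv j s t →
      ∃ a ∈ Subgroup.centralizer ({j} : Set G), a⁻¹ * t * a = s
  centralizer_eq : ∀ s : G, IsInvol s → s ≠ j → ∀ x : G,
      x ∈ Subgroup.centralizer ({j * s} : Set G) ↔
        x = 1 ∨ ∃ s' : G, IsInvol s' ∧ JEquiv j s' s ∧ x = j * s'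
  unique_minimal : ∀ s : G, IsInvol s →
      ¬ (∃ a ∈ Subgroup.centralizer ({j} : Set G),
           ∃ b ∈ Subgroup.centralizer ({j} : Set G), s = a * t * b) →
      ∃! s' : G, IsInvol s' ∧ JEquiv j s' s ∧ JMinimal j s'

theorem IsInvol.mul_self {G : Type*} [Group G] {s : G} (h : IsInvol s) : s * s = 1 := by
  rw [← pow_two, ← show orderOf s = 2 from h, pow_orderOf_eq_one]

theorem IsInvol.ne_one {G : Type*} [Group G] {s : G} (h : IsInvol s) : s ≠ 1 := by
  rintro rfl
  simp [IsInvol] at h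

theorem IsInvol.conj {G : Type*} [Group G] {s : G} (h : IsInvol s) (g : G) :
    IsInvol (g * s * g⁻¹) :=
  orderOf_eq_prime (by rw [conj_pow, pow_two, h.mul_self, mul_one, mul_inv_cancel])
    (by rw [Ne, conj_eq_one_iff]; exact h.ne_one)

/-- No involution centralizes a product of two distinct involutions. -/
theorem StandingHyp.eq_of_commute_mul {G : Type*} [Group G] {j t t' : G}
    (H : StandingHyp j t t') {u r s : G} (hu : IsInvol u) (hr : IsInvol r) (hs : IsInvol s)
    (h : Commute u (r * s)) : r = s := by
  by_contra hne
  obtain ⟨g, hg⟩ := isConj_iff.mp (H.all_conj r j hr H.invol_j)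
  have hsj : g * s * g⁻¹ ≠ j := fun e => hne ((MulAut.conj g).injective (hg.trans e.symm))
  have hprod : j * (g * s * g⁻¹) = g * (r * s) * g⁻¹ := by rw [← hg]; group
  have hmem : g * u * g⁻¹ ∈ Subgroup.centralizer ({j * (g * s * g⁻¹)} : Set G) := by
    rw [Subgroup.mem_centralizer_singleton_iff, hprod]
    exact (h.map (MulAut.conj g)).eq
  have hu' := hu.conj g
  rcases (H.centralizer_eq _ (hs.conj g) hsj _).mp hmem with h1 | ⟨v, hv, -, hv'⟩
  · exact hu'.ne_one h1
  · have hjv : j ≠ v := by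
      rintro rfl
      exact hu'.ne_one (hv'.trans hv.mul_self)
    apply H.infinite_order j v H.invol_j hv hjv
    rw [← hv', ← orderOf_pos_iff, show orderOf (g * u * g⁻¹) = 2 from hu']
    norm_num

/-- if `r, s ∉ A` are involutions with `s = a·r·b` for `a, b ∈ A`, then `b = a⁻¹`. -/
theorem conj_invol_in_A {G : Type*} [Group G] (j t t' : G)
    (H : StandingHyp j t t') (r s a b : G)
    (hr : IsInvol r) (hs : IsInvol s)
    (hrA : r ∉ Subgroup.centralizer ({j} : Set G))
    (hsA : s ∉ Subgroup.centralizer ({j} : Set G))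
    (ha : a ∈ Subgroup.centralizer ({j} : Set G))
    (hb : b ∈ Subgroup.centralizer ({j} : Set G))
    (hab : s = a * r * b) : b = a⁻¹ := by
  have hs' : IsInvol (a⁻¹ * s * a) := by simpa using hs.conj a⁻¹
  have hprod : r * (a⁻¹ * s * a) = b * a := by
    calc r * (a⁻¹ * s * a) = r * r * (b * a) := by rw [hab]; group
      _ = b * a := by rw [hr.mul_self, one_mul]
  have hcomm : Commute j (r * (a⁻¹ * s * a)) := by
    rw [hprod]
    exact (Subgroup.mem_centralizer_singleton_iff.mp (mul_mem hb ha)).symm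
  have heq := H.eq_of_commute_mul H.invol_j hr hs' hcomm
  rw [← heq, hr.mul_self] at hprod
  exact eq_inv_of_mul_eq_one_left hprod.symm
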